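/- Let 𝒜 = (I, (A_a)_{a∈Σ}, F) be a minimal WFA with n states whose ω-function is not identically zero (i.e., there exists w ∈ Σ^ω such that f_𝒜(w) is defined and nonzero). Then 𝒜 is uniformly convergent if and only if there exists an invertible n×n real matrix M such that for every a ∈ Σ the conjugate M⁻¹ A_a M has the block form [[B_a, b_a],[0, 1]] — i.e., its last row equals (0,…,0,1) — where B_a is (n−1)×(n−1), b_a is a column vector, and {B_a : a ∈ Σ} is a stable set. -/

import Mathlib

open Filter Topology Matrix

/-- The prefix of length `k` of an infinite word `w`. -/
def pref {A : Type*} (w : ℕ → A) (k : ℕ) : List A := (List.range k).map w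

/-- The product `A_{v₁} ⋯ A_{v_k}` of matrices along a finite word `v`. -/
def wordProd {A : Type*} {n : ℕ} (M : A → Matrix (Fin n) (Fin n) ℝ) (v : List A) :
    Matrix (Fin n) (Fin n) ℝ := (v.map M).prod

/-- The word function of the WFA `(I, M, F)`: `v ↦ I A_v F`. -/
def wfaWord {A : Type*} {n : ℕ} (I : Fin n → ℝ) (M : A → Matrix (Fin n) (Fin n) ℝ)
    (F : Fin n → ℝ) (v : List A) : ℝ := I ⬝ᵥ (wordProd M v) *ᵥ F

/-- The WFA with `n` states is left minimal: the row vectors `I A_u` span `ℝⁿ`. -/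
def LeftMinimal {A : Type*} {n : ℕ} (I : Fin n → ℝ)
    (M : A → Matrix (Fin n) (Fin n) ℝ) : Prop :=
  Submodule.span ℝ {x : Fin n → ℝ | ∃ u : List A, x = I ᵥ* (wordProd M u)} = ⊤

/-- The WFA with `n` states is right minimal: the column vectors `A_u F` span `ℝⁿ`. -/
def RightMinimal {A : Type*} {n : ℕ} (M : A → Matrix (Fin n) (Fin n) ℝ)
    (F : Fin n → ℝ) : Prop :=
  Submodule.span ℝ {x : Fin n → ℝ | ∃ u : List A, x = (wordProd M u) *ᵥ F} = ⊤

/-- A word function `F : Σ* → ℝ` is uniformly convergent with ω-function `f`. -/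
def UnifConv {A : Type*} (F : List A → ℝ) (f : (ℕ → A) → ℝ) : Prop :=
  (∀ w : ℕ → A, Tendsto (fun k => F (pref w k)) atTop (𝓝 (f w))) ∧
  ∀ ε > (0 : ℝ), ∃ k₀ : ℕ, ∀ w : ℕ → A, ∀ k > k₀, |F (pref w k) - f w| < ε

/-- A family of square matrices is stable: all infinite products tend to zero. -/
def IsStable {A : Type*} {m : ℕ} (M : A → Matrix (Fin m) (Fin m) ℝ) : Prop :=
  ∀ w : ℕ → A, Tendsto (fun k => wordProd M (pref w k)) atTop (𝓝 0)section Words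

variable {A : Type*}

/-- The infinite word `u w`. -/
def appendWord (u : List A) (w : ℕ → A) : ℕ → A := fun i => u.getD i (w (i - u.length))

theorem pref_length (w : ℕ → A) (k : ℕ) : (pref w k).length = k := by simp [pref]

theorem pref_succ (w : ℕ → A) (k : ℕ) : pref w (k + 1) = pref w k ++ [w k] := by
  simp [pref, List.range_succ]

theorem pref_appendWord (u : List A) (w : ℕ → A) (k : ℕ) :
    pref (appendWord u w) (u.length + k) = u ++ pref w k := by
  unfold pref
  rw [List.range_add, List.map_append]
  congr 1
  · apply List.ext_getElem
    · simp
    · intro i h₁ h₂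
      simp [appendWord, h₂]
  · simp [appendWord]

theorem pref_appendWord_length (u : List A) (w : ℕ → A) :
    pref (appendWord u w) u.length = u := by
  simpa [pref] using pref_appendWord u w 0

theorem take_pref (w : ℕ → A) {k m : ℕ} (h : k ≤ m) : (pref w m).take k = pref w k := by
  simp [pref, ← List.map_take, List.take_range, h]

end Words

section Stable

variable {A R : Type*} [Fintype A] [NormedRing R]

/-- By compactness of the space of infinite words, a stable family contracts every infinite word
after a uniformly bounded number of letters. -/
theorem exists_uniform_contraction (b : A → R)
    (hb : ∀ w : ℕ → A, Tendsto (fun k => ((pref w k).map b).prod) atTop (𝓝 0)) :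
    ∃ K : ℕ, ∀ w : ℕ → A, ∃ k, 0 < k ∧ k ≤ K ∧ ‖((pref w k).map b).prod‖ < 1 / 2 := by
  let _ : TopologicalSpace A := ⊥
  have : DiscreteTopology A := ⟨rfl⟩
  let U : ℕ → Set (ℕ → A) := fun k => {w | ‖((pref w (k + 1)).map b).prod‖ < 1 / 2}
  have hcont : ∀ k, Continuous fun w : ℕ → A => ((pref w k).map b).prod := by
    intro k
    induction k with
    | zero => simpa [pref] using continuous_const
    | succ k ih =>
      simp only [pref_succ, List.map_append, List.prod_append, List.map_cons, List.map_nil,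
        List.prod_singleton]
      exact ih.mul (continuous_of_discreteTopology.comp (continuous_apply k))
  have hU : ∀ k, IsOpen (U k) := fun k => isOpen_lt (hcont (k + 1)).norm continuous_const
  have hcover : (Set.univ : Set (ℕ → A)) ⊆ ⋃ k, U k := by
    intro w _
    have h := ((tendsto_add_atTop_iff_nat 1).2 (hb w)).norm
    rw [norm_zero] at h
    obtain ⟨k, hk⟩ := (h.eventually (gt_mem_nhds (by norm_num : (0 : ℝ) < 1 / 2))).exists
    exact Set.mem_iUnion.2 ⟨k, hk⟩
  obtain ⟨t, ht⟩ := isCompact_univ.elim_finite_subcover U hU hcover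
  refine ⟨t.sup id + 1, fun w => ?_⟩
  obtain ⟨k, hk, hw⟩ := Set.mem_iUnion₂.1 (ht (Set.mem_univ w))
  exact ⟨k + 1, k.succ_pos, Nat.succ_le_succ (Finset.le_sup (f := id) hk), hw⟩

/-- The products of a stable family decay exponentially in the length of the word. -/
theorem exists_exponential_decay [Nonempty A] (b : A → R)
    (hb : ∀ w : ℕ → A, Tendsto (fun k => ((pref w k).map b).prod) atTop (𝓝 0)) :
    ∃ C ρ : ℝ, 0 ≤ C ∧ ρ < 1 ∧ 0 < ρ ∧ ∀ v : List A, ‖(v.map b).prod‖ ≤ C * ρ ^ v.length := by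
  obtain ⟨K, hK⟩ := exists_uniform_contraction b hb
  have hK0 : 0 < K := by
    obtain ⟨k, h₁, h₂, -⟩ := hK fun _ => Classical.arbitrary A
    omega
  have hK1 : (1 : ℝ) ≤ K := by exact_mod_cast hK0
  obtain ⟨ρ, hρ0, hρ1, hρK⟩ : ∃ ρ : ℝ, 0 < ρ ∧ ρ < 1 ∧ 1 / 2 ≤ ρ ^ K := by
    have hpos : 0 < 1 / (2 * (K : ℝ)) := by positivity
    have hle : 1 / (2 * (K : ℝ)) ≤ 1 / 2 := by
      apply one_div_le_one_div_of_le <;> linarith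
    refine ⟨1 + -(1 / (2 * (K : ℝ))), by linarith, by linarith, ?_⟩
    refine le_trans (le_of_eq ?_) (one_add_mul_le_pow (by linarith) K)
    field_simp
    norm_num
  obtain ⟨β, hβ1, hβ⟩ : ∃ β : ℝ, 1 ≤ β ∧ ∀ a, ‖b a‖ ≤ β := by
    refine ⟨1 + ∑ a, ‖b a‖, ?_, fun a => ?_⟩
    · linarith [Finset.sum_nonneg fun a (_ : a ∈ Finset.univ) => norm_nonneg (b a)]
    · linarith [Finset.single_le_sum (fun a _ => norm_nonneg (b a)) (Finset.mem_univ a)]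
  have hgrow : ∀ v : List A, ‖(v.map b).prod‖ ≤ ‖(1 : R)‖ * β ^ v.length := by
    intro v
    induction v with
    | nil => simp
    | cons a v ih =>
      rw [List.map_cons, List.prod_cons, List.length_cons]
      calc _ ≤ ‖b a‖ * ‖(v.map b).prod‖ := norm_mul_le _ _
        _ ≤ β * (‖(1 : R)‖ * β ^ v.length) := by gcongr; exact hβ a
        _ = _ := by ring
  set C : ℝ := ‖(1 : R)‖ * β ^ K * 2 with hC
  have hC0 : 0 ≤ C := by positivity
  refine ⟨C, ρ, hC0, hρ1, hρ0, fun v => ?_⟩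
  induction hm : v.length using Nat.strong_induction_on generalizing v with
  | _ m ih =>
    by_cases hv : m < K
    · have h₁ : 1 / 2 ≤ ρ ^ m := hρK.trans (pow_le_pow_of_le_one hρ0.le hρ1.le hv.le)
      calc _ ≤ ‖(1 : R)‖ * β ^ m := hm ▸ hgrow v
        _ ≤ ‖(1 : R)‖ * β ^ K := by gcongr
        _ = C * (1 / 2) := by rw [hC]; ring
        _ ≤ _ := by gcongr
    · obtain ⟨k, hk0, hkK, hk⟩ := hK (appendWord v fun _ => Classical.arbitrary A)
      have hkv : k ≤ v.length := by omega
      rw [← take_pref _ hkv, pref_appendWord_length] at hk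
      have hdrop := ih (m - k) (by omega) (v.drop k) (by simp [hm])
      have h₂ : 1 / 2 ≤ ρ ^ k := hρK.trans (pow_le_pow_of_le_one hρ0.le hρ1.le hkK)
      rw [← List.take_append_drop k v, List.map_append, List.prod_append]
      calc _ ≤ ‖((v.take k).map b).prod‖ * ‖((v.drop k).map b).prod‖ := norm_mul_le _ _
        _ ≤ ρ ^ k * (C * ρ ^ (m - k)) := by gcongr; exact hk.le.trans h₂
        _ = C * (ρ ^ k * ρ ^ (m - k)) := by ring
        _ = _ := by rw [← pow_add, Nat.add_sub_cancel' (by omega)]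

end Stable

section MatrixProducts

variable {A : Type*} {n : ℕ}

theorem wordProd_append (M : A → Matrix (Fin n) (Fin n) ℝ) (u v : List A) :
    wordProd M (u ++ v) = wordProd M u * wordProd M v := by
  simp [wordProd]

theorem wordProd_cons (M : A → Matrix (Fin n) (Fin n) ℝ) (a : A) (v : List A) :
    wordProd M (a :: v) = M a * wordProd M v := by
  simp [wordProd]

theorem wordProd_singleton (M : A → Matrix (Fin n) (Fin n) ℝ) (a : A) :
    wordProd M [a] = M a := by
  simp [wordProd]

theorem wordProd_conj (M : A → Matrix (Fin n) (Fin n) ℝ) {P : Matrix (Fin n) (Fin n) ℝ}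
    (hP : IsUnit P) (v : List A) :
    wordProd (fun a => P⁻¹ * M a * P) v = P⁻¹ * wordProd M v * P := by
  have hdet := (Matrix.isUnit_iff_isUnit_det P).1 hP
  induction v with
  | nil => simp [wordProd, Matrix.nonsing_inv_mul P hdet]
  | cons a v ih =>
    rw [wordProd_cons, wordProd_cons, ih]
    simp only [Matrix.mul_assoc, Matrix.mul_nonsing_inv_cancel_left P _ hdet]

variable {N : A → Matrix (Fin (n + 1)) (Fin (n + 1)) ℝ}

theorem wordProd_last (hN : ∀ a j, N a (Fin.last n) j = if j = Fin.last n then 1 else 0)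
    (v : List A) (j : Fin (n + 1)) :
    wordProd N v (Fin.last n) j = if j = Fin.last n then 1 else 0 := by
  induction v with
  | nil => simp [wordProd, Matrix.one_apply, eq_comm]
  | cons a v ih => simp [wordProd_cons, Matrix.mul_apply, hN, ih]

theorem wordProd_castSucc (hN : ∀ a j, N a (Fin.last n) j = if j = Fin.last n then 1 else 0)
    (v : List A) (i j : Fin n) :
    wordProd N v i.castSucc j.castSucc =
      wordProd (fun a => Matrix.of fun i j : Fin n => N a i.castSucc j.castSucc) v i j := by
  induction v generalizing i with
  | nil => simp [wordProd, Matrix.one_apply]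
  | cons a v ih =>
    simp [wordProd_cons, Matrix.mul_apply, Fin.sum_univ_castSucc, wordProd_last hN, ih]

end MatrixProducts

section Decay

open scoped Matrix.Norms.Operator

theorem IsStable.exists_entry_bound {A : Type*} [Fintype A] [Nonempty A] {m : ℕ}
    {B : A → Matrix (Fin m) (Fin m) ℝ} (hB : IsStable B) :
    ∃ C ρ : ℝ, 0 ≤ C ∧ ρ < 1 ∧ 0 < ρ ∧
      ∀ (v : List A) (i j : Fin m), |wordProd B v i j| ≤ C * ρ ^ v.length := by
  obtain ⟨C, ρ, hC, hρ1, hρ0, h⟩ := exists_exponential_decay B hB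
  refine ⟨C, ρ, hC, hρ1, hρ0, fun v i j => le_trans ?_ (h v)⟩
  rw [← Real.norm_eq_abs, ← coe_nnnorm, ← coe_nnnorm, NNReal.coe_le_coe,
    Matrix.linfty_opNNNorm_def]
  exact (Finset.single_le_sum (f := fun j => ‖wordProd B v i j‖₊) (fun _ _ => zero_le)
    (Finset.mem_univ j)).trans
    (Finset.le_sup (f := fun i => ∑ j, ‖wordProd B v i j‖₊) (Finset.mem_univ i))

end Decay

/-- Every nonzero row vector is the last row of an invertible matrix. -/
theorem exists_isUnit_last_row {n : ℕ} {L : Fin (n + 1) → ℝ} (hL : L ≠ 0) :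
    ∃ Q : Matrix (Fin (n + 1)) (Fin (n + 1)) ℝ, IsUnit Q ∧ Q (Fin.last n) = L := by
  obtain ⟨j, hj⟩ := Function.ne_iff.1 hL
  refine ⟨((1 : Matrix _ _ ℝ).updateRow j L).submatrix (Equiv.swap j (Fin.last n)) id, ?_, ?_⟩
  · rw [Matrix.isUnit_iff_isUnit_det, Matrix.det_permute, isUnit_iff_ne_zero,
      ← Matrix.cramer_transpose_apply]
    have hs : ((Equiv.Perm.sign (Equiv.swap j (Fin.last n)) : ℤ) : ℝ) ≠ 0 := by
      exact_mod_cast Units.ne_zero _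
    simpa using hj
  · ext k
    simp

section UniformConvergence

variable {A : Type*} {n : ℕ} {I F : Fin n → ℝ} {M : A → Matrix (Fin n) (Fin n) ℝ}

theorem wfaWord_append (u v : List A) :
    wfaWord I M F (u ++ v) = (I ᵥ* wordProd M u) ⬝ᵥ (wordProd M v *ᵥ F) := by
  rw [wfaWord, wordProd_append, ← Matrix.mulVec_mulVec, Matrix.dotProduct_mulVec]

/-- Inserting a fixed word after a prefix does not change the limit of a uniformly convergent
word function. -/
theorem UnifConv.tendsto_pref_append {G : List A → ℝ} {f : (ℕ → A) → ℝ} (h : UnifConv G f)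
    (w : ℕ → A) (u : List A) : Tendsto (fun k => G (pref w k ++ u)) atTop (𝓝 (f w)) := by
  rw [Metric.tendsto_atTop]
  intro ε hε
  obtain ⟨k₀, hk₀⟩ := h.2 (ε / 3) (by positivity)
  refine ⟨k₀ + 1, fun k hk => ?_⟩
  set w' := appendWord (pref w k ++ u) w
  have e₁ : pref w' (k + u.length) = pref w k ++ u := by
    have := pref_appendWord_length (pref w k ++ u) w
    rwa [List.length_append, pref_length] at this
  have e₂ : pref w' k = pref w k := by
    rw [← take_pref w' (Nat.le_add_right k u.length), e₁, List.take_left' (pref_length w k)]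
  have h₁ := hk₀ w' (k + u.length) (by omega)
  have h₂ := hk₀ w' k (by omega)
  have h₃ := hk₀ w k (by omega)
  rw [e₁] at h₁
  rw [e₂] at h₂
  rw [Real.dist_eq]
  rw [abs_lt] at *
  constructor <;> linarith [h₁.1, h₁.2, h₂.1, h₂.2, h₃.1, h₃.2]

theorem RightMinimal.eq_of_dotProduct_eq (hr : RightMinimal M F) {x y : Fin n → ℝ}
    (h : ∀ u, x ⬝ᵥ (wordProd M u *ᵥ F) = y ⬝ᵥ (wordProd M u *ᵥ F)) : x = y := by
  refine dotProduct_eq x y fun z => ?_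
  have hz : z ∈ Submodule.span ℝ {x : Fin n → ℝ | ∃ u : List A, x = wordProd M u *ᵥ F} := by
    rw [show Submodule.span ℝ _ = ⊤ from hr]; trivial
  induction hz using Submodule.span_induction with
  | mem z hz => obtain ⟨u, rfl⟩ := hz; exact h u
  | zero => simp
  | add a b _ _ ha hb => rw [dotProduct_add, dotProduct_add, ha, hb]
  | smul c a _ ha => rw [dotProduct_smul, dotProduct_smul, ha]

/-- For a uniformly convergent right minimal automaton the state vectors converge along every
infinite word. -/
theorem UnifConv.exists_tendsto_state {f : (ℕ → A) → ℝ} (h : UnifConv (wfaWord I M F) f)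
    (hr : RightMinimal M F) (w : ℕ → A) :
    ∃ L : Fin n → ℝ, Tendsto (fun k => I ᵥ* wordProd M (pref w k)) atTop (𝓝 L) ∧
      ∀ u, L ⬝ᵥ (wordProd M u *ᵥ F) = f w := by
  have hlim : ∀ z : Fin n → ℝ, ∃ c : ℝ,
      Tendsto (fun k => (I ᵥ* wordProd M (pref w k)) ⬝ᵥ z) atTop (𝓝 c) := by
    intro z
    have hz : z ∈ Submodule.span ℝ {x : Fin n → ℝ | ∃ u : List A, x = wordProd M u *ᵥ F} := by
      rw [show Submodule.span ℝ _ = ⊤ from hr]; trivial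
    induction hz using Submodule.span_induction with
    | mem z hz =>
      obtain ⟨u, rfl⟩ := hz
      exact ⟨f w, by simpa only [wfaWord_append] using h.tendsto_pref_append w u⟩
    | zero => exact ⟨0, by simp⟩
    | add a b _ _ ha hb =>
      obtain ⟨c, hc⟩ := ha
      obtain ⟨d, hd⟩ := hb
      exact ⟨c + d, by simpa only [dotProduct_add] using hc.add hd⟩
    | smul r a _ ha =>
      obtain ⟨c, hc⟩ := ha
      exact ⟨r • c, by simpa only [dotProduct_smul] using hc.const_smul r⟩
  choose c hc using fun i => hlim (Pi.single i 1)
  have hL : Tendsto (fun k => I ᵥ* wordProd M (pref w k)) atTop (𝓝 c) := by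
    rw [tendsto_pi_nhds]
    intro i
    simpa using hc i
  refine ⟨c, hL, fun u => ?_⟩
  have h₁ : Tendsto (fun k => (I ᵥ* wordProd M (pref w k)) ⬝ᵥ (wordProd M u *ᵥ F)) atTop
      (𝓝 (c ⬝ᵥ (wordProd M u *ᵥ F))) :=
    ((Continuous.dotProduct continuous_id continuous_const).tendsto c).comp hL
  refine tendsto_nhds_unique h₁ ?_
  simpa only [wfaWord_append] using h.tendsto_pref_append w u

/-- A uniformly convergent minimal automaton with nonzero ω-function has a nonzero common left
fixed vector which spans all limits of products of its transition matrices. -/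
theorem UnifConv.exists_fixed_vector {f : (ℕ → A) → ℝ} (h : UnifConv (wfaWord I M F) f)
    (hl : LeftMinimal I M) (hr : RightMinimal M F) {w₀ : ℕ → A} (hw₀ : f w₀ ≠ 0) :
    ∃ L : Fin n → ℝ, L ≠ 0 ∧ (∀ a, L ᵥ* M a = L) ∧
      ∀ (x : Fin n → ℝ) (w : ℕ → A), ∃ c : ℝ,
        Tendsto (fun k => x ᵥ* wordProd M (pref w k)) atTop (𝓝 (c • L)) := by
  obtain ⟨L, -, hLF⟩ := h.exists_tendsto_state hr w₀
  refine ⟨L, ?_, fun a => ?_, fun x w => ?_⟩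
  · rintro rfl
    exact hw₀ (by simpa using (hLF []).symm)
  · refine hr.eq_of_dotProduct_eq fun u => ?_
    rw [← Matrix.dotProduct_mulVec, Matrix.mulVec_mulVec, ← wordProd_cons, hLF, hLF]
  · have hx : x ∈ Submodule.span ℝ {x : Fin n → ℝ | ∃ u : List A, x = I ᵥ* wordProd M u} := by
      rw [show Submodule.span ℝ _ = ⊤ from hl]; trivial
    induction hx using Submodule.span_induction with
    | mem x hx =>
      obtain ⟨u, rfl⟩ := hx
      obtain ⟨L', hL', hLF'⟩ := h.exists_tendsto_state hr (appendWord u w)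
      refine ⟨f (appendWord u w) / f w₀, ?_⟩
      have e : (f (appendWord u w) / f w₀) • L = L' := by
        refine hr.eq_of_dotProduct_eq fun v => ?_
        rw [smul_dotProduct, hLF, hLF', smul_eq_mul, div_mul_cancel₀ _ hw₀]
      rw [e]
      have hshift := (tendsto_add_atTop_iff_nat u.length).2 hL'
      refine hshift.congr fun k => ?_
      rw [add_comm k, pref_appendWord, wordProd_append, Matrix.vecMul_vecMul]
    | zero => exact ⟨0, by simp⟩
    | add a b _ _ ha hb =>
      obtain ⟨c, hc⟩ := ha
      obtain ⟨d, hd⟩ := hb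
      exact ⟨c + d, by simpa only [Matrix.add_vecMul, add_smul] using hc.add hd⟩
    | smul r a _ ha =>
      obtain ⟨c, hc⟩ := ha
      exact ⟨r * c, by simpa only [Matrix.smul_vecMul, mul_smul] using hc.const_smul r⟩

/-- A word function whose increments decay geometrically is uniformly convergent. -/
theorem exists_unifConv_of_le_geometric {G : List A → ℝ} {D ρ : ℝ} (hρ0 : 0 < ρ) (hρ1 : ρ < 1)
    (hG : ∀ v a, |G (v ++ [a]) - G v| ≤ D * ρ ^ v.length) : ∃ f, UnifConv G f := by
  have hstep : ∀ (w : ℕ → A) (k : ℕ), dist (G (pref w k)) (G (pref w (k + 1))) ≤ D * ρ ^ k := by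
    intro w k
    have := hG (pref w k) (w k)
    rwa [pref_length, ← pref_succ, abs_sub_comm, ← Real.dist_eq] at this
  choose f hf using fun w =>
    cauchySeq_tendsto_of_complete (cauchySeq_of_le_geometric ρ D hρ1 (hstep w))
  refine ⟨f, hf, fun ε hε => ?_⟩
  have h₀ : Tendsto (fun k => D * ρ ^ k / (1 - ρ)) atTop (𝓝 0) := by
    simpa using ((tendsto_pow_atTop_nhds_zero_of_lt_one hρ0.le hρ1).const_mul D).div_const (1 - ρ)
  obtain ⟨k₀, hk₀⟩ := eventually_atTop.1 (h₀.eventually (gt_mem_nhds hε))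
  refine ⟨k₀, fun w k hk => ?_⟩
  rw [← Real.dist_eq]
  exact (dist_le_of_le_geometric_of_tendsto ρ D hρ1 (hstep w) (hf w) k).trans_lt (hk₀ k hk.le)

end UniformConvergence

/-- The increments of an automaton in canonical form with stable diagonal blocks decay
geometrically. -/
theorem exists_unifConv_of_canonical_form {A : Type*} [Fintype A] [Nonempty A] {n : ℕ}
    (I F : Fin (n + 1) → ℝ) {N : A → Matrix (Fin (n + 1)) (Fin (n + 1)) ℝ}
    (hN : ∀ a j, N a (Fin.last n) j = if j = Fin.last n then 1 else 0)
    (hB : IsStable fun a => Matrix.of fun i j : Fin n => N a i.castSucc j.castSucc) :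
    ∃ f, UnifConv (wfaWord I N F) f := by
  obtain ⟨C, ρ, hC, hρ1, hρ0, hbound⟩ := hB.exists_entry_bound
  let y : A → Fin (n + 1) → ℝ := fun a => N a *ᵥ F - F
  have hy : ∀ a, y a (Fin.last n) = 0 := by
    intro a
    simp [y, Matrix.mulVec, dotProduct, hN]
  let D : A → ℝ := fun a => ∑ i : Fin n, ∑ j : Fin n, |I i.castSucc| * C * |y a j.castSucc|
  have hD : ∀ a, 0 ≤ D a := fun a => by positivity
  refine exists_unifConv_of_le_geometric (D := ∑ a, D a) hρ0 hρ1 fun v a => ?_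
  have e : wfaWord I N F (v ++ [a]) - wfaWord I N F v =
      ∑ i : Fin n, ∑ j : Fin n, I i.castSucc *
        (wordProd N v i.castSucc j.castSucc * y a j.castSucc) := by
    rw [wfaWord, wfaWord, wordProd_append, wordProd_singleton, ← Matrix.mulVec_mulVec,
      ← dotProduct_sub, ← Matrix.mulVec_sub]
    change I ⬝ᵥ wordProd N v *ᵥ y a = _
    simp [dotProduct, Matrix.mulVec, Fin.sum_univ_castSucc, hy, wordProd_last hN, Finset.mul_sum]
  rw [e]
  calc _ ≤ ∑ i : Fin n, ∑ j : Fin n, |I i.castSucc| * C * |y a j.castSucc| * ρ ^ v.length := by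
        refine (Finset.abs_sum_le_sum_abs _ _).trans (Finset.sum_le_sum fun i _ => ?_)
        refine (Finset.abs_sum_le_sum_abs _ _).trans (Finset.sum_le_sum fun j _ => ?_)
        rw [abs_mul, abs_mul, wordProd_castSucc hN]
        calc _ ≤ |I i.castSucc| * (C * ρ ^ v.length * |y a j.castSucc|) := by
              gcongr; exact hbound v i j
          _ = _ := by ring
    _ = D a * ρ ^ v.length := by simp only [D, Finset.sum_mul]
    _ ≤ _ := by
        gcongr
        exact Finset.single_le_sum (fun a _ => hD a) (Finset.mem_univ a)

theorem wfaWord_conj {A : Type*} {n : ℕ} (I F : Fin n → ℝ) (M : A → Matrix (Fin n) (Fin n) ℝ)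
    {P : Matrix (Fin n) (Fin n) ℝ} (hP : IsUnit P) :
    wfaWord (I ᵥ* P) (fun a => P⁻¹ * M a * P) (P⁻¹ *ᵥ F) = wfaWord I M F := by
  have hdet := (Matrix.isUnit_iff_isUnit_det P).1 hP
  funext v
  rw [wfaWord, wfaWord, wordProd_conj M hP, ← Matrix.dotProduct_mulVec, Matrix.mulVec_mulVec,
    Matrix.mulVec_mulVec]
  congr 2
  rw [Matrix.mul_assoc P⁻¹, Matrix.mul_nonsing_inv_cancel_left P _ hdet,
    Matrix.mul_nonsing_inv_cancel_right P _ hdet]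

/-- Let `𝒜 = (I, (A_a), F)` be a minimal WFA with `n + 1` states whose ω-function is not
identically zero (there is a `w` where it is defined and nonzero).  Then `𝒜` is uniformly
convergent iff in some basis (i.e. after conjugating by an invertible matrix `P`) every
transition matrix has the block form `[[B_a, b_a], [0, 1]]` — its last row is `(0, …, 0, 1)` —
where the matrices `B_a` (the top-left `n × n` corners) form a stable set. -/
theorem canonical_form_of_uniformly_convergent
    {A : Type*} [Fintype A] [Nonempty A]
    {n : ℕ} (I : Fin (n + 1) → ℝ) (M : A → Matrix (Fin (n + 1)) (Fin (n + 1)) ℝ)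
    (F : Fin (n + 1) → ℝ)
    (hl : LeftMinimal I M) (hr : RightMinimal M F)
    (hne : ∃ (w : ℕ → A) (c : ℝ), c ≠ 0 ∧
      Tendsto (fun k => wfaWord I M F (pref w k)) atTop (𝓝 c)) :
    (∃ f : (ℕ → A) → ℝ, UnifConv (wfaWord I M F) f) ↔
      ∃ P : Matrix (Fin (n + 1)) (Fin (n + 1)) ℝ, IsUnit P ∧
        (∀ (a : A) (j : Fin (n + 1)),
          (P⁻¹ * M a * P) (Fin.last n) j = if j = Fin.last n then 1 else 0) ∧
        IsStable (fun a =>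
          Matrix.of fun i j : Fin n => (P⁻¹ * M a * P) i.castSucc j.castSucc) := by
  constructor
  · rintro ⟨f, hf⟩
    obtain ⟨w₀, c₀, hc₀, hlim⟩ := hne
    have hw₀ : f w₀ ≠ 0 := tendsto_nhds_unique (hf.1 w₀) hlim ▸ hc₀
    obtain ⟨L, hL0, hLM, hLlim⟩ := hf.exists_fixed_vector hl hr hw₀
    obtain ⟨Q, hQ, hQL⟩ := exists_isUnit_last_row hL0
    have hdet := (Matrix.isUnit_iff_isUnit_det Q).1 hQ
    have hP : IsUnit Q⁻¹ := (Matrix.isUnit_nonsing_inv_iff).2 hQ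
    have hLQ : ∀ j, (L ᵥ* Q⁻¹) j = if j = Fin.last n then 1 else 0 := by
      intro j
      rw [← hQL, ← Matrix.mul_apply_eq_vecMul, Matrix.mul_nonsing_inv Q hdet, Matrix.one_apply]
      simp only [eq_comm]
    have hlast : ∀ (a : A) (j : Fin (n + 1)),
        (Q⁻¹⁻¹ * M a * Q⁻¹) (Fin.last n) j = if j = Fin.last n then 1 else 0 := by
      intro a j
      rw [Matrix.nonsing_inv_nonsing_inv Q hdet, Matrix.mul_apply_eq_vecMul,
        Matrix.mul_apply_eq_vecMul, hQL, hLM, hLQ]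
    refine ⟨Q⁻¹, hP, hlast, fun w => ?_⟩
    refine tendsto_pi_nhds.2 fun i => tendsto_pi_nhds.2 fun j => ?_
    obtain ⟨c, hc⟩ := hLlim (Q i.castSucc) w
    have hcQ := ((Continuous.matrix_vecMul continuous_id
      (continuous_const (y := Q⁻¹))).tendsto (c • L)).comp hc
    have hij := (tendsto_pi_nhds.1 hcQ) j.castSucc
    have hzero : (id (c • L) ᵥ* Q⁻¹) j.castSucc = 0 := by
      simp [Matrix.smul_vecMul, hLQ]
    rw [hzero] at hij
    refine hij.congr fun k => ?_
    rw [← wordProd_castSucc hlast, wordProd_conj M hP, Matrix.nonsing_inv_nonsing_inv Q hdet,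
      Matrix.mul_apply_eq_vecMul, Matrix.mul_apply_eq_vecMul]
    rfl
  · rintro ⟨P, hP, hlast, hB⟩
    rw [← wfaWord_conj I F M hP]
    exact exists_unifConv_of_canonical_form _ _ hlast hB
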